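/- arXiv:1002.3933 — 4 statements merged into one kernel-verified Lean document; each statement's English description precedes it below -/
import Mathlib

section
/- A word of length 2 belongs to L(Ω) if and only if it is of the form k1 for some 1 ≤ k ≤ d, or of the form k(k+1) for some 1 ≤ k ≤ d−1. In particular L(Ω) contains exactly 2d−1 words of length 2. -/
/-- The substitution σ on the alphabet A = {1, …, d}:
σ(1) = 12, σ(k) = k+1 for 2 ≤ k ≤ d−1, σ(d) = 1. Letters are literal natural numbers. -/
def sig (d : ℕ) (a : ℕ) : List ℕ :=
  if a = 1 then [1, 2] else if a = d then [1] else [a + 1]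

/-- Extension of a substitution to finite words by concatenation. -/
def applySub (f : ℕ → List ℕ) : List ℕ → List ℕ
  | [] => []
  | a :: w => f a ++ applySub f w

/-- σⁿ applied to a word. -/
def sigIter (d n : ℕ) (w : List ℕ) : List ℕ := (applySub (sig d))^[n] w

/-- The language L(Ω): the set of finite factors of the fixed point ω, i.e. of the
words σⁿ(1). -/
def Lang (d : ℕ) (u : List ℕ) : Prop := ∃ n : ℕ, u <:+: sigIter d n [1]

/-- `w` is a (finite) prefix of the infinite word `V`. -/
def PrefixOfInf (w : List ℕ) (V : ℕ → ℕ) : Prop :=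
  ∀ (i : ℕ) (h : i < w.length), w.get ⟨i, h⟩ = V i

/-- `ω` is the fixed point of σ: the unique infinite word admitting every σⁿ(1) as a
prefix. -/
def IsSigmaFixedPoint (d : ℕ) (ω : ℕ → ℕ) : Prop :=
  ∀ n : ℕ, PrefixOfInf (sigIter d n [1]) ω

/-- `u` is left-special: there are distinct letters a, b ∈ A with au, bu ∈ L(Ω). -/
def LeftSpecial (d : ℕ) (u : List ℕ) : Prop :=
  ∃ a b : ℕ, a ≠ b ∧ 1 ≤ a ∧ a ≤ d ∧ 1 ≤ b ∧ b ≤ d ∧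
    Lang d (a :: u) ∧ Lang d (b :: u)

/-- `u` is right-special: there are distinct letters a, b ∈ A with ua, ub ∈ L(Ω). -/
def RightSpecial (d : ℕ) (u : List ℕ) : Prop :=
  ∃ a b : ℕ, a ≠ b ∧ 1 ≤ a ∧ a ≤ d ∧ 1 ≤ b ∧ b ≤ d ∧
    Lang d (u ++ [a]) ∧ Lang d (u ++ [b])

/-- `u` is bispecial: both left- and right-special. -/
def Bispecial (d : ℕ) (u : List ℕ) : Prop := LeftSpecial d u ∧ RightSpecial d u

/-- The shift S on infinite words. -/
def shiftMap (V : ℕ → ℕ) : ℕ → ℕ := fun i => V (i + 1)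

/-- Ω⁺ : the closure (for the product topology, letters discrete) of the shift
orbit of ω. -/
def OmegaPlus (ω : ℕ → ℕ) : Set (ℕ → ℕ) :=
  closure {V : ℕ → ℕ | ∃ n : ℕ, V = shiftMap^[n] ω}

/-- The cylinder C_u = {V ∈ Ω⁺ : u is a prefix of V}. -/
def Cyl (ω : ℕ → ℕ) (u : List ℕ) : Set (ℕ → ℕ) :=
  {V | V ∈ OmegaPlus ω ∧ PrefixOfInf u V}

/-- Prepending a letter to an infinite word. -/
def consInf (a : ℕ) (V : ℕ → ℕ) : ℕ → ℕ :=
  fun i => match i with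
  | 0 => a
  | j + 1 => V j

/-- Extension of σ to infinite words: σ(V) = σ(V₀)σ(V₁)σ(V₂)⋯ (each σ(a) is a
nonempty word, so the n-th letter of σ(V) is the n-th letter of σ(V₀…Vₙ)). -/
def sigInf (d : ℕ) (V : ℕ → ℕ) : ℕ → ℕ :=
  fun n => (applySub (sig d) ((List.range (n + 1)).map V)).getD n 0

/-- Concatenation of a finite list of words. -/
def concatAll : List (List ℕ) → List ℕ
  | [] => []
  | w :: ws => w ++ concatAll ws

theorem applySub_append (f : ℕ → List ℕ) (u v : List ℕ) :
    applySub f (u ++ v) = applySub f u ++ applySub f v := by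
  induction u with
  | nil => rfl
  | cons a u ih => simp [applySub, ih]

theorem sigIter_succ (d n : ℕ) (w : List ℕ) :
    sigIter d (n + 1) w = applySub (sig d) (sigIter d n w) :=
  Function.iterate_succ_apply' _ _ _

theorem Lang.of_infix {d : ℕ} {u v : List ℕ} (hv : Lang d v) (h : u <:+: v) : Lang d u :=
  let ⟨n, hn⟩ := hv
  ⟨n, h.trans hn⟩

theorem Lang.applySub {d : ℕ} {u : List ℕ} (hu : Lang d u) : Lang d (applySub (sig d) u) := by
  obtain ⟨n, s, t, h⟩ := hu
  exact ⟨n + 1, _root_.applySub (sig d) s, _root_.applySub (sig d) t, by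
    rw [sigIter_succ, ← h, applySub_append, applySub_append]⟩

/-- The letter `b` may follow the letter `a` in the language of the fixed point. -/
def Follows (d a b : ℕ) : Prop := 1 ≤ a ∧ a ≤ d ∧ (b = 1 ∨ (b = a + 1 ∧ a < d))

theorem isChain_applySub {d : ℕ} (hd : 3 ≤ d) {w : List ℕ} (hw : w.IsChain (Follows d)) :
    (applySub (sig d) w).IsChain (Follows d) := by
  induction w with
  | nil => simp [applySub]
  | cons a w ih =>
    cases w with
    | nil =>
      simp only [applySub, sig]
      split_ifs <;> grind [Follows]
    | cons b w =>
      rw [List.isChain_cons_cons] at hw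
      obtain ⟨hab, hbw⟩ := hw
      have hbw := ih hbw
      simp only [applySub, sig] at hbw ⊢
      split_ifs at hbw ⊢ <;> grind [Follows]

theorem isChain_sigIter {d : ℕ} (hd : 3 ≤ d) (n : ℕ) :
    (sigIter d n [1]).IsChain (Follows d) := by
  induction n with
  | zero => simp [sigIter]
  | succ n ih =>
    rw [sigIter_succ]
    exact isChain_applySub hd ih

theorem lang_one_two (d : ℕ) : Lang d [1, 2] :=
  ⟨1, by simp [sigIter, applySub, sig]⟩

theorem lang_self_succ {d k : ℕ} (hk : 1 ≤ k) (hkd : k + 1 ≤ d) : Lang d [k, k + 1] := by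
  induction k, hk using Nat.le_induction with
  | base => exact lang_one_two d
  | succ k hk ih =>
    refine (ih (by omega)).applySub.of_infix ?_
    by_cases h : k = 1
    · subst h
      exact ⟨[1], [], by simp [applySub, sig]; omega⟩
    · exact ⟨[], [], by
        simp [applySub, sig, h, show k ≠ d by omega, show k ≠ 0 by omega,
          show k + 1 ≠ d by omega]⟩

theorem lang_last_one {d : ℕ} (hd : 3 ≤ d) : Lang d [d, 1] := by
  obtain ⟨e, rfl⟩ : ∃ e, d = e + 1 := ⟨d - 1, by omega⟩
  refine (lang_self_succ (d := e + 1) (k := e) (by omega) le_rfl).applySub.of_infix ?_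
  exact ⟨[], [], by simp [applySub, sig, show e ≠ 1 by omega, show e ≠ 0 by omega]⟩

theorem lang_one_one {d : ℕ} (hd : 3 ≤ d) : Lang d [1, 1] :=
  (lang_last_one hd).applySub.of_infix
    ⟨[], [2], by simp [applySub, sig, show d ≠ 1 by omega]⟩

theorem lang_letter_one {d k : ℕ} (hd : 3 ≤ d) (hk : 1 ≤ k) (hkd : k ≤ d) : Lang d [k, 1] := by
  induction k, hk using Nat.le_induction with
  | base => exact lang_one_one hd
  | succ k hk ih =>
    refine (ih (by omega)).applySub.of_infix ?_
    by_cases h : k = 1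
    · subst h
      exact ⟨[1], [2], by simp [applySub, sig]⟩
    · exact ⟨[], [2], by simp [applySub, sig, h, show k ≠ d by omega]⟩

theorem lang_pair_iff {d : ℕ} (hd : 3 ≤ d) (a b : ℕ) : Lang d [a, b] ↔ Follows d a b := by
  constructor
  · rintro ⟨n, h⟩
    simpa using (isChain_sigIter hd n).infix h
  · rintro ⟨h1, h2, rfl | ⟨rfl, h3⟩⟩
    · exact lang_letter_one hd h1 h2
    · exact lang_self_succ h1 h3

/-- A word of length 2 is in L(Ω) iff it is of the form k1 (1 ≤ k ≤ d) or k(k+1)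
(1 ≤ k ≤ d−1); in particular L(Ω) contains exactly 2d−1 words of length 2. -/
theorem stmt_3 (d : ℕ) (hd : 3 ≤ d) :
    (∀ u : List ℕ, u.length = 2 →
      (Lang d u ↔ (∃ k : ℕ, 1 ≤ k ∧ k ≤ d ∧ u = [k, 1]) ∨
        (∃ k : ℕ, 1 ≤ k ∧ k ≤ d - 1 ∧ u = [k, k + 1]))) ∧
    Set.ncard {u : List ℕ | Lang d u ∧ u.length = 2} = 2 * d - 1 := by
  have key : ∀ u : List ℕ, u.length = 2 →
      (Lang d u ↔ (∃ k : ℕ, 1 ≤ k ∧ k ≤ d ∧ u = [k, 1]) ∨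
        (∃ k : ℕ, 1 ≤ k ∧ k ≤ d - 1 ∧ u = [k, k + 1])) := by
    intro u hu
    obtain ⟨a, b, rfl⟩ := List.length_eq_two.mp hu
    rw [lang_pair_iff hd]
    constructor
    · rintro ⟨h1, h2, rfl | ⟨rfl, h3⟩⟩
      · exact Or.inl ⟨a, h1, h2, rfl⟩
      · exact Or.inr ⟨a, h1, by omega, rfl⟩
    · rintro (⟨k, h1, h2, h⟩ | ⟨k, h1, h2, h⟩) <;> simp at h <;> obtain ⟨rfl, rfl⟩ := h
      · exact ⟨h1, h2, Or.inl rfl⟩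
      · exact ⟨h1, by omega, Or.inr ⟨rfl, by omega⟩⟩
  refine ⟨key, ?_⟩
  have hset : {u : List ℕ | Lang d u ∧ u.length = 2} =
      ((Finset.Icc 1 d).image (fun k => [k, 1]) ∪
        (Finset.Icc 1 (d - 1)).image (fun k => [k, k + 1]) : Finset (List ℕ)) := by
    ext u
    simp only [Set.mem_ofPred_eq, Finset.coe_union, Finset.coe_image, Finset.coe_Icc,
      Set.mem_union, Set.mem_image, Set.mem_Icc]
    constructor
    · rintro ⟨h, hu⟩
      rcases (key u hu).mp h with ⟨k, h1, h2, rfl⟩ | ⟨k, h1, h2, rfl⟩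
      · exact Or.inl ⟨k, ⟨h1, h2⟩, rfl⟩
      · exact Or.inr ⟨k, ⟨h1, h2⟩, rfl⟩
    · rintro (⟨k, ⟨h1, h2⟩, rfl⟩ | ⟨k, ⟨h1, h2⟩, rfl⟩)
      · exact ⟨(key _ rfl).mpr (Or.inl ⟨k, h1, h2, rfl⟩), rfl⟩
      · exact ⟨(key _ rfl).mpr (Or.inr ⟨k, h1, h2, rfl⟩), rfl⟩
  rw [hset, Set.ncard_coe_finset, Finset.card_union_of_disjoint,
    Finset.card_image_of_injective, Finset.card_image_of_injective]
  · simp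
    omega
  · intro a b h
    simpa using h
  · intro a b h
    simpa using h
  · rw [Finset.disjoint_left]
    intro u h1 h2
    simp only [Finset.mem_image, Finset.mem_Icc] at h1 h2
    obtain ⟨k, _, rfl⟩ := h1
    obtain ⟨l, hl, h⟩ := h2
    simp at h
    omega
end

section
/- The substitution σ is primitive: there exists N ∈ ℕ such that for every n ≥ N and all letters i, j ∈ A, the letter i occurs in the word σⁿ(j). Equivalently, the incidence matrix M_σ (the d×d matrix whose (i,j) entry is the number of occurrences of the letter i in σ(j)) has a power with all entries strictly positive. -/
theorem mem_applySub {f : ℕ → List ℕ} {w : List ℕ} {a : ℕ} :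
    a ∈ applySub f w ↔ ∃ b ∈ w, a ∈ f b := by
  induction w with
  | nil => simp [applySub]
  | cons b w ih => simp [applySub, ih]

theorem sigIter_add (d m n : ℕ) (w : List ℕ) :
    sigIter d (m + n) w = sigIter d m (sigIter d n w) :=
  Function.iterate_add_apply _ m n w

theorem mem_sigIter_succ {d n : ℕ} {w : List ℕ} {a : ℕ} :
    a ∈ sigIter d (n + 1) w ↔ ∃ b ∈ sigIter d n w, a ∈ sig d b := by
  rw [sigIter, Function.iterate_succ_apply', mem_applySub, sigIter]

theorem add_one_mem_sig {d a : ℕ} (h : a < d) : a + 1 ∈ sig d a := by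
  unfold sig
  split_ifs <;> simp <;> omega

theorem one_mem_sig_one (d : ℕ) : 1 ∈ sig d 1 := by
  simp [sig]

theorem one_mem_sig_self (d : ℕ) : 1 ∈ sig d d := by
  by_cases h : d = 1 <;> simp [sig, h]

/-- For `d ≥ 2` the substitution maps letters to words over the alphabet `{1, …, d}`. -/
theorem mem_Icc_of_mem_sig {d a b : ℕ} (hd : 2 ≤ d) (ha : a ∈ Set.Icc 1 d) (h : b ∈ sig d a) :
    b ∈ Set.Icc 1 d := by
  rw [Set.mem_Icc] at *
  unfold sig at h
  split_ifs at h <;> simp at h <;> omega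

theorem mem_Icc_of_mem_sigIter {d n j b : ℕ} (hd : 2 ≤ d) (hj : j ∈ Set.Icc 1 d)
    (h : b ∈ sigIter d n [j]) : b ∈ Set.Icc 1 d := by
  induction n generalizing b with
  | zero => simp_all [sigIter]
  | succ n ih =>
    obtain ⟨a, ha, hb⟩ := mem_sigIter_succ.1 h
    exact mem_Icc_of_mem_sig hd (ih ha) hb

theorem add_mem_sigIter {d m a : ℕ} {w : List ℕ} (ha : a ∈ w) (h : a + m ≤ d) :
    a + m ∈ sigIter d m w := by
  induction m with
  | zero => exact ha
  | succ m ih => exact mem_sigIter_succ.2 ⟨a + m, ih (by omega), add_one_mem_sig (by omega)⟩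

theorem one_mem_sigIter {d : ℕ} {w : List ℕ} (h : 1 ∈ w) (n : ℕ) : 1 ∈ sigIter d n w := by
  induction n with
  | zero => exact h
  | succ n ih => exact mem_sigIter_succ.2 ⟨1, ih, one_mem_sig_one d⟩

theorem one_mem_sigIter_singleton {d j n : ℕ} (hj : j ∈ Set.Icc 1 d) (hn : d ≤ n) :
    1 ∈ sigIter d n [j] := by
  obtain ⟨hj₁, hj₂⟩ := hj
  have hd : d ∈ sigIter d (d - j) [j] := by
    have := add_mem_sigIter (d := d) (m := d - j) (List.mem_singleton_self j) (by omega)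
    rwa [Nat.add_sub_cancel' hj₂] at this
  have h₁ : 1 ∈ sigIter d (d - j + 1) [j] := mem_sigIter_succ.2 ⟨d, hd, one_mem_sig_self d⟩
  have h₂ := one_mem_sigIter (d := d) h₁ (n - (d - j + 1))
  rwa [← sigIter_add, Nat.sub_add_cancel (by omega)] at h₂

theorem mem_sigIter_of_two_mul_le {d i j n : ℕ} (hi : i ∈ Set.Icc 1 d) (hj : j ∈ Set.Icc 1 d)
    (hn : 2 * d ≤ n) : i ∈ sigIter d n [j] := by
  obtain ⟨hi₁, hi₂⟩ := hi
  have h₁ : 1 ∈ sigIter d (n - (i - 1)) [j] := one_mem_sigIter_singleton hj (by omega)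
  have h₂ := add_mem_sigIter (d := d) (m := i - 1) h₁ (by omega)
  rwa [← sigIter_add, Nat.add_sub_cancel' (by omega), Nat.add_sub_cancel' hi₁] at h₂

theorem incidence_pow_pos {d : ℕ} (hd : 2 ≤ d) (n : ℕ) (i j : Fin d)
    (h : (i : ℕ) + 1 ∈ sigIter d n [(j : ℕ) + 1]) :
    0 < ((Matrix.of fun i j : Fin d =>
      (sig d ((j : ℕ) + 1)).count ((i : ℕ) + 1)) ^ n) i j := by
  induction n generalizing i with
  | zero =>
    obtain rfl : i = j := by simpa [sigIter, Fin.ext_iff] using h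
    simp
  | succ n ih =>
    obtain ⟨a, ha, hi⟩ := mem_sigIter_succ.1 h
    obtain ⟨ha₁, ha₂⟩ := mem_Icc_of_mem_sigIter hd ⟨by omega, by omega⟩ ha
    obtain ⟨k, rfl⟩ : ∃ k : Fin d, a = (k : ℕ) + 1 := ⟨⟨a - 1, by omega⟩, by simp; omega⟩
    rw [pow_succ', Matrix.mul_apply]
    exact Finset.sum_pos' (fun _ _ => Nat.zero_le _)
      ⟨k, Finset.mem_univ k, Nat.mul_pos (List.count_pos_iff.2 hi) (ih k ha)⟩

/-- σ is primitive: there is N such that for all n ≥ N every letter i ∈ A occurs in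
σⁿ(j) for every j ∈ A; equivalently, the incidence matrix of σ (whose (i,j) entry is
the number of occurrences of the letter i in σ(j)) has a power with all entries
strictly positive. -/
theorem stmt_10 (d : ℕ) (hd : 3 ≤ d) :
    (∃ N : ℕ, ∀ n, N ≤ n → ∀ i j : ℕ, 1 ≤ i → i ≤ d → 1 ≤ j → j ≤ d →
      i ∈ sigIter d n [j]) ∧
    (∃ n : ℕ, ∀ i j : Fin d,
      0 < ((Matrix.of fun i j : Fin d =>
        (sig d ((j : ℕ) + 1)).count ((i : ℕ) + 1)) ^ n) i j) := by
  refine ⟨⟨2 * d, fun n hn i j hi₁ hi₂ hj₁ hj₂ =>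
    mem_sigIter_of_two_mul_le ⟨hi₁, hi₂⟩ ⟨hj₁, hj₂⟩ hn⟩, 2 * d, fun i j => ?_⟩
  exact incidence_pow_pos (by omega) _ i j
    (mem_sigIter_of_two_mul_le ⟨by omega, by omega⟩ ⟨by omega, by omega⟩ le_rfl)
end

section
/- For every letter i ∈ A, the two-letter word 12 is a prefix of σ^d(i). (This is the key step showing that σ satisfies the strong coincidence condition: for all i, j ∈ A, the second letters of σ^d(i) and σ^d(j) coincide and their length-1 prefixes have equal abelianizations.) -/
theorem prefix_applySub_sig (d : ℕ) {w : List ℕ} (h : [1, 2] <+: w) :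
    [1, 2] <+: applySub (sig d) w := by
  obtain ⟨t, rfl⟩ := h
  simp [applySub, sig]

theorem prefix_sigIter_succ (d n : ℕ) : [1, 2] <+: sigIter d (n + 1) [1] := by
  induction n with
  | zero => simp [sigIter, applySub, sig]
  | succ n ih =>
    rw [sigIter, Function.iterate_succ_apply']
    exact prefix_applySub_sig d ih

theorem sigIter_singleton_of_add_le (d n i : ℕ) (hi : 2 ≤ i) (h : i + n ≤ d) :
    sigIter d n [i] = [i + n] := by
  induction n with
  | zero => simp [sigIter]
  | succ n ih =>
    have ih' := ih (by omega)
    rw [sigIter] at ih' ⊢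
    rw [Function.iterate_succ_apply', ih']
    have h₁ : i + n ≠ 1 := by omega
    have h₂ : i + n ≠ d := by omega
    simp [applySub, sig, h₁, h₂, add_assoc]

/-- For every letter i ∈ A, the two-letter word 12 is a prefix of σ^d(i). -/
theorem stmt_11 (d : ℕ) (hd : 3 ≤ d) (i : ℕ) (h1 : 1 ≤ i) (h2 : i ≤ d) :
    [1, 2] <+: sigIter d d [i] := by
  obtain rfl | hi : i = 1 ∨ 2 ≤ i := by omega
  · obtain ⟨n, rfl⟩ : ∃ n, d = n + 1 := ⟨d - 1, by omega⟩
    exact prefix_sigIter_succ _ n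
  · have hsplit : d = (i - 2 + 1) + (1 + (d - i)) := by omega
    have hlast : sigIter d (d - i) [i] = [d] := by
      rw [sigIter_singleton_of_add_le d (d - i) i hi (by omega)]
      congr 1
      omega
    have hone : applySub (sig d) [d] = [1] := by
      have hd₁ : d ≠ 1 := by omega
      simp [applySub, sig, hd₁]
    have key : sigIter d d [i] = sigIter d (i - 2 + 1) [1] := by
      unfold sigIter at hlast ⊢
      conv_lhs => rw [show (applySub (sig d))^[d] =
        (applySub (sig d))^[(i - 2 + 1) + (1 + (d - i))] from congrArg _ hsplit]
      rw [Function.iterate_add_apply _ (i - 2 + 1), Function.iterate_add_apply _ 1, hlast,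
        Function.iterate_one, hone]
    rw [key]
    exact prefix_sigIter_succ d (i - 2)
end

section
/- Every infinite word of Ω⁺ whose first letter is different from 2 has a σ-preimage in Ω⁺: if V ∈ Ω⁺ and V_0 ≠ 2, then there exists V' ∈ Ω⁺ with σ(V') = V. -/
theorem sig_length_pos (d a : ℕ) : 1 ≤ (sig d a).length := by
  unfold sig; split_ifs <;> simp

theorem length_le_length_applySub (d : ℕ) (u : List ℕ) :
    u.length ≤ (applySub (sig d) u).length := by
  induction u with
  | nil => simp
  | cons a u ih =>
    have := sig_length_pos d a
    simp only [applySub, List.length_cons, List.length_append]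
    omega

theorem mem_applySub_le {d : ℕ} (hd : 3 ≤ d) {u : List ℕ} (hu : ∀ a ∈ u, a ≤ d) :
    ∀ a ∈ applySub (sig d) u, a ≤ d := by
  induction u with
  | nil => simp [applySub]
  | cons b u ih =>
    intro a ha
    rw [applySub, List.mem_append] at ha
    rcases ha with ha | ha
    · have hb := hu b (by simp)
      unfold sig at ha
      split_ifs at ha <;> simp at ha <;> omega
    · exact ih (fun c hc => hu c (by simp [hc])) a ha

theorem mem_sigIter_le {d : ℕ} (hd : 3 ≤ d) (n : ℕ) : ∀ a ∈ sigIter d n [1], a ≤ d := by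
  induction n with
  | zero => simp [sigIter]; omega
  | succ n ih =>
    rw [sigIter, Function.iterate_succ_apply']
    exact mem_applySub_le hd ih

theorem exists_sigIter_eq_cons (d n : ℕ) :
    ∃ t : List ℕ, sigIter d n [1] = 1 :: t ∧ n ≤ t.length := by
  induction n with
  | zero => exact ⟨[], rfl, le_rfl⟩
  | succ n ih =>
    obtain ⟨t, ht, hn⟩ := ih
    refine ⟨2 :: applySub (sig d) t, ?_, ?_⟩
    · rw [sigIter, Function.iterate_succ_apply']
      rw [sigIter] at ht
      simp [ht, applySub, sig]
    · have := length_le_length_applySub d t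
      simp only [List.length_cons]
      omega

theorem lt_length_sigIter (d n : ℕ) : n < (sigIter d n [1]).length := by
  obtain ⟨t, ht, hn⟩ := exists_sigIter_eq_cons d n
  rw [ht, List.length_cons]
  omega

theorem PrefixOfInf.eq_map_range {w : List ℕ} {V : ℕ → ℕ} (h : PrefixOfInf w V) :
    w = (List.range w.length).map V := by
  refine List.ext_getElem (by simp) fun i h₁ h₂ => ?_
  simpa using h i h₁

theorem PrefixOfInf.getD_eq {w : List ℕ} {V : ℕ → ℕ} (h : PrefixOfInf w V) {i : ℕ}
    (hi : i < w.length) : w.getD i 0 = V i := by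
  rw [List.getD_eq_getElem _ _ hi]
  exact h i hi

/-- Any sufficiently long prefix of `V` computes the letters of `sigInf d V`. -/
theorem sigInf_eq_getD (d : ℕ) (V : ℕ → ℕ) {n N : ℕ} (h : n < N) :
    sigInf d V n = (applySub (sig d) ((List.range N).map V)).getD n 0 := by
  obtain ⟨k, rfl⟩ := Nat.exists_eq_add_of_le (Nat.succ_le_of_lt h)
  have hlen := length_le_length_applySub d ((List.range (n + 1)).map V)
  rw [List.length_map, List.length_range] at hlen
  rw [sigInf, List.range_add (n := n.succ), List.map_append, applySub_append,
    List.getD_append _ _ _ _ hlen]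

theorem sigInf_fixedPoint {d : ℕ} {ω : ℕ → ℕ} (hω : IsSigmaFixedPoint d ω) :
    sigInf d ω = ω := by
  funext n
  have hn := lt_length_sigIter d n
  rw [sigInf_eq_getD d ω hn, ← (hω n).eq_map_range]
  have hsucc : applySub (sig d) (sigIter d n [1]) = sigIter d (n + 1) [1] := by
    rw [sigIter, sigIter, Function.iterate_succ_apply']
  rw [hsucc]
  exact (hω (n + 1)).getD_eq ((Nat.lt_succ_self n).trans (lt_length_sigIter d (n + 1)))

theorem fixedPoint_le {d : ℕ} (hd : 3 ≤ d) {ω : ℕ → ℕ} (hω : IsSigmaFixedPoint d ω) (i : ℕ) :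
    ω i ≤ d := by
  have hi := lt_length_sigIter d i
  rw [← hω i i hi]
  exact mem_sigIter_le hd i _ (List.get_mem _ _)

theorem applySub_map_range_succ (d : ℕ) (V : ℕ → ℕ) (N : ℕ) :
    applySub (sig d) ((List.range (N + 1)).map V) =
      sig d (V 0) ++ applySub (sig d) ((List.range N).map (shiftMap V)) := by
  rw [List.range_succ_eq_map, List.map_cons, List.map_map]
  rfl

theorem sigInf_length_add (d : ℕ) (V : ℕ → ℕ) (j : ℕ) :
    sigInf d V ((sig d (V 0)).length + j) = sigInf d (shiftMap V) j := by
  have h : j < (sig d (V 0)).length + j := by have := sig_length_pos d (V 0); omega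
  rw [sigInf, applySub_map_range_succ, List.getD_append_right _ _ _ _ (by omega),
    Nat.add_sub_cancel_left, sigInf_eq_getD d (shiftMap V) h]

theorem shiftMap_sigInf_of_ne_one {d : ℕ} {V : ℕ → ℕ} (h : V 0 ≠ 1) :
    shiftMap (sigInf d V) = sigInf d (shiftMap V) := by
  have hl : (sig d (V 0)).length = 1 := by rw [sig, if_neg h]; split_ifs <;> rfl
  funext j
  rw [← sigInf_length_add, hl, shiftMap, add_comm]

theorem shiftMap_shiftMap_sigInf_of_eq_one {d : ℕ} {V : ℕ → ℕ} (h : V 0 = 1) :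
    shiftMap (shiftMap (sigInf d V)) = sigInf d (shiftMap V) := by
  have hl : (sig d (V 0)).length = 2 := by simp [sig, h]
  funext j
  rw [← sigInf_length_add, hl, shiftMap, shiftMap, add_comm 2 j]

theorem sigInf_one_of_eq_one {d : ℕ} {V : ℕ → ℕ} (h : V 0 = 1) : sigInf d V 1 = 2 := by
  rw [sigInf, applySub_map_range_succ, h]
  simp [sig]

/-- A shift of `sigInf d W` either starts at the image of a letter of `W`, or at the second
letter of the image of a letter `1` of `W`. -/
theorem shiftMap_iterate_sigInf (d : ℕ) (W : ℕ → ℕ) (n : ℕ) :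
    ∃ m, shiftMap^[n] (sigInf d W) = sigInf d (shiftMap^[m] W) ∨
      (shiftMap^[m] W) 0 = 1 ∧
        shiftMap^[n] (sigInf d W) = shiftMap (sigInf d (shiftMap^[m] W)) := by
  induction n with
  | zero => exact ⟨0, Or.inl rfl⟩
  | succ n ih =>
    simp only [Function.iterate_succ_apply' shiftMap n]
    obtain ⟨m, hm | ⟨h1, hm⟩⟩ := ih
    · by_cases h1 : (shiftMap^[m] W) 0 = 1
      · exact ⟨m, Or.inr ⟨h1, by rw [hm]⟩⟩
      · refine ⟨m + 1, Or.inl ?_⟩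
        rw [hm, shiftMap_sigInf_of_ne_one h1, Function.iterate_succ_apply']
    · refine ⟨m + 1, Or.inl ?_⟩
      rw [hm, shiftMap_shiftMap_sigInf_of_eq_one h1, Function.iterate_succ_apply']

theorem continuous_sigInf (d : ℕ) : Continuous (sigInf d) := by
  refine continuous_pi fun n => ?_
  have hfac : (fun V : ℕ → ℕ => sigInf d V n) =
      (fun v : Fin (n + 1) → ℕ => (applySub (sig d) (List.ofFn v)).getD n 0) ∘
        fun V i => V i := by
    funext V
    have hmap : (List.range (n + 1)).map V = List.ofFn fun i : Fin (n + 1) => V i :=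
      List.ext_getElem (by simp) fun i h₁ h₂ => by
        rw [List.getElem_map, List.getElem_range, List.getElem_ofFn]
    simp only [sigInf, Function.comp_apply, hmap]
  rw [hfac]
  exact continuous_of_discreteTopology.comp (by fun_prop)

theorem shiftMap_iterate_apply (V : ℕ → ℕ) (n i : ℕ) : (shiftMap^[n] V) i = V (i + n) := by
  induction n generalizing V with
  | zero => rfl
  | succ n ih => rw [Function.iterate_succ_apply, ih, shiftMap, add_assoc]

theorem isCompact_omegaPlus {d : ℕ} (hd : 3 ≤ d) {ω : ℕ → ℕ} (hω : IsSigmaFixedPoint d ω) :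
    IsCompact (OmegaPlus ω) := by
  have hK : IsCompact (Set.univ.pi fun _ : ℕ => Set.Iic d) :=
    isCompact_univ_pi fun _ => (Set.finite_Iic d).isCompact
  refine hK.of_isClosed_subset isClosed_closure (closure_minimal ?_ hK.isClosed)
  rintro _ ⟨n, rfl⟩ i -
  rw [Set.mem_Iic, shiftMap_iterate_apply]
  exact fixedPoint_le hd hω _

/-- Every V ∈ Ω⁺ whose first letter is different from 2 has a σ-preimage in Ω⁺. -/
theorem stmt_13 (d : ℕ) (hd : 3 ≤ d) (ω : ℕ → ℕ) (hω : IsSigmaFixedPoint d ω)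
    (V : ℕ → ℕ) (hV : V ∈ OmegaPlus ω) (h0 : V 0 ≠ 2) :
    ∃ V' ∈ OmegaPlus ω, sigInf d V' = V := by
  have hopen : IsOpen {U : ℕ → ℕ | U 0 ≠ 2} :=
    isOpen_ne_fun (continuous_apply 0) continuous_const
  have hclosed : IsClosed (sigInf d '' OmegaPlus ω) :=
    ((isCompact_omegaPlus hd hω).image (continuous_sigInf d)).isClosed
  refine closure_minimal ?_ hclosed (hopen.inter_closure ⟨h0, hV⟩)
  rintro _ ⟨hne, n, rfl⟩
  obtain ⟨m, hm | ⟨h1, hm⟩⟩ := shiftMap_iterate_sigInf d ω n <;> rw [sigInf_fixedPoint hω] at hm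
  · exact ⟨_, subset_closure ⟨m, rfl⟩, hm.symm⟩
  · refine absurd ?_ hne
    rw [hm]
    exact sigInf_one_of_eq_one h1
end
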